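/- (Non-convergence under resonant spillback.) Let η ∈ (0,1), C > 0, Δ > 0, and let u_Δ be the Δ-periodic on-and-off signal with split η. If the downstream supply resonates with the signal, i.e. S(τ) = C·u_Δ(τ), then for every t ≥ 0, ∫₀ᵗ S(τ) u_Δ(τ) dτ − η ∫₀ᵗ S(τ) dτ = (1−η) C ∫₀ᵗ u_Δ(τ) dτ ≥ C η (1−η) t. In particular, for fixed t > 0 this difference is bounded below by Cη(1−η)t > 0 uniformly in Δ, so the on-and-off downstream boundary condition does not converge to the continuum one as Δ → 0⁺. -/

import Mathlib

/-- The Δ-periodic on-and-off traffic signal with split η: equal to 1 (green)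
during the first ηΔ of each cycle of length Δ, and 0 (red) otherwise. -/
noncomputable def uOnOff (Δ η τ : ℝ) : ℝ :=
  if τ - Δ * (⌊τ / Δ⌋ : ℝ) < η * Δ then 1 else 0

theorem uOnOff_mul_self (Δ η τ : ℝ) : uOnOff Δ η τ * uOnOff Δ η τ = uOnOff Δ η τ := by
  unfold uOnOff
  split_ifs <;> norm_num

theorem measurable_uOnOff (Δ η : ℝ) : Measurable (uOnOff Δ η) := by
  unfold uOnOff
  refine Measurable.ite (measurableSet_lt ?_ measurable_const) measurable_const measurable_const
  have h : Measurable fun τ : ℝ => ((⌊τ / Δ⌋ : ℤ) : ℝ) :=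
    measurable_from_top.comp (Int.measurable_floor.comp (measurable_id.div_const Δ))
  exact measurable_id.sub (h.const_mul Δ)

theorem intervalIntegrable_uOnOff (Δ η a b : ℝ) :
    IntervalIntegrable (uOnOff Δ η) MeasureTheory.volume a b := by
  refine (intervalIntegrable_const (c := (1 : ℝ))).mono_fun
    (measurable_uOnOff Δ η).aestronglyMeasurable (Filter.Eventually.of_forall fun τ => ?_)
  simp only [uOnOff]
  split_ifs <;> simp

theorem periodic_uOnOff {Δ : ℝ} (hΔ : Δ ≠ 0) (η : ℝ) : Function.Periodic (uOnOff Δ η) Δ := by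
  intro τ
  unfold uOnOff
  rw [add_div, div_self hΔ, Int.floor_add_one]
  push_cast
  congr 2
  ring

theorem uOnOff_of_mem_Ico {Δ τ : ℝ} (η : ℝ) (hτ : τ ∈ Set.Ico 0 Δ) :
    uOnOff Δ η τ = if τ < η * Δ then 1 else 0 := by
  have hΔ : 0 < Δ := hτ.1.trans_lt hτ.2
  have h : ⌊τ / Δ⌋ = 0 :=
    Int.floor_eq_zero_iff.2 ⟨div_nonneg hτ.1 hΔ.le, (div_lt_one hΔ).2 hτ.2⟩
  simp [uOnOff, h]

/-- Within the first cycle, the accumulated green time is `min s (η * Δ)`. -/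
theorem integral_uOnOff_of_mem_Icc {Δ η s : ℝ} (hη : 0 ≤ η) (hs : s ∈ Set.Icc 0 Δ) :
    ∫ τ in (0:ℝ)..s, uOnOff Δ η τ = min s (η * Δ) := by
  have hm : 0 ≤ min s (η * Δ) := le_min hs.1 (mul_nonneg hη (hs.1.trans hs.2))
  have green : ∫ τ in (0:ℝ)..min s (η * Δ), uOnOff Δ η τ = ∫ _ in (0:ℝ)..min s (η * Δ), (1:ℝ) := by
    refine intervalIntegral.integral_congr_Ioo_of_le hm fun τ hτ => ?_
    have h := lt_min_iff.1 hτ.2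
    rw [uOnOff_of_mem_Ico η ⟨hτ.1.le, h.1.trans_le hs.2⟩, if_pos h.2]
  have red : ∫ τ in min s (η * Δ)..s, uOnOff Δ η τ = ∫ _ in min s (η * Δ)..s, (0:ℝ) := by
    refine intervalIntegral.integral_congr_Ioo_of_le (min_le_left _ _) fun τ hτ => ?_
    have h : η * Δ < τ := (min_lt_iff.1 hτ.1).resolve_left hτ.2.not_gt
    rw [uOnOff_of_mem_Ico η ⟨hm.trans hτ.1.le, hτ.2.trans_le hs.2⟩, if_neg h.not_gt]
  rw [← intervalIntegral.integral_add_adjacent_intervals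
    (intervalIntegrable_uOnOff Δ η 0 (min s (η * Δ))) (intervalIntegrable_uOnOff Δ η _ s),
    green, red]
  simp

/-- The accumulated green time is at least the fraction `η` of the elapsed time. -/
theorem mul_le_integral_uOnOff {Δ η t : ℝ} (hΔ : 0 < Δ) (hη : η ∈ Set.Icc (0:ℝ) 1) :
    η * t ≤ ∫ τ in (0:ℝ)..t, uOnOff Δ η τ := by
  have hint (a b : ℝ) :
      IntervalIntegrable (fun τ => uOnOff Δ η τ - η) MeasureTheory.volume a b :=
    (intervalIntegrable_uOnOff Δ η a b).sub intervalIntegrable_const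
  have hper : Function.Periodic (fun τ => uOnOff Δ η τ - η) Δ := fun τ => by
    simp only [periodic_uOnOff hΔ.ne' η τ]
  have hval (s : ℝ) : ∫ τ in (0:ℝ)..s, (uOnOff Δ η τ - η) =
      (∫ τ in (0:ℝ)..s, uOnOff Δ η τ) - η * s := by
    rw [intervalIntegral.integral_sub (intervalIntegrable_uOnOff Δ η 0 s)
      intervalIntegrable_const]
    simp [mul_comm]
  have hcycle : ∫ τ in (0:ℝ)..Δ, (uOnOff Δ η τ - η) = 0 := by
    rw [hval, integral_uOnOff_of_mem_Icc hη.1 ⟨hΔ.le, le_rfl⟩,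
      min_eq_right (mul_le_of_le_one_left hΔ.le hη.2), sub_self]
  have hpartial : 0 ≤ sInf ((fun s => ∫ τ in (0:ℝ)..s, (uOnOff Δ η τ - η)) '' Set.Icc 0 Δ) := by
    refine Real.sInf_nonneg ?_
    rintro _ ⟨s, hs, rfl⟩
    simp only [hval]
    rw [integral_uOnOff_of_mem_Icc hη.1 hs, sub_nonneg]
    exact le_min (mul_le_of_le_one_left hs.1 hη.2) (mul_le_mul_of_nonneg_left hs.2 hη.1)
  have h := hper.sInf_add_zsmul_le_integral_of_pos (hint 0 Δ) hΔ t
  rw [hcycle, smul_zero, add_zero, hval] at h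
  linarith

/-- **Non-convergence under resonant spillback.** If the downstream supply resonates with
the signal, `S(τ) = C·u_Δ(τ)`, then for every `t ≥ 0` the difference between the
on-and-off and continuum downstream boundary conditions equals `(1−η)C ∫₀ᵗ u_Δ` and is
bounded below by `Cη(1−η)t`, uniformly in `Δ`; hence for fixed `t > 0` it stays bounded
away from `0` (by `Cη(1−η)t > 0`) as `Δ → 0⁺`. -/
theorem onOff_resonant_nonconvergence (η C : ℝ) (hη : η ∈ Set.Ioo (0:ℝ) 1) (hC : 0 < C)
    (Δ : ℝ) (hΔ : 0 < Δ) (S : ℝ → ℝ) (hS : ∀ τ, S τ = C * uOnOff Δ η τ) :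
    (∀ t : ℝ, 0 ≤ t →
      (∫ τ in (0:ℝ)..t, S τ * uOnOff Δ η τ) - η * ∫ τ in (0:ℝ)..t, S τ =
        (1 - η) * C * ∫ τ in (0:ℝ)..t, uOnOff Δ η τ ∧
      C * η * (1 - η) * t ≤
        (∫ τ in (0:ℝ)..t, S τ * uOnOff Δ η τ) - η * ∫ τ in (0:ℝ)..t, S τ) ∧
    (∀ t : ℝ, 0 < t → 0 < C * η * (1 - η) * t) := by
  have key (t : ℝ) : (∫ τ in (0:ℝ)..t, S τ * uOnOff Δ η τ) - η * ∫ τ in (0:ℝ)..t, S τ =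
      (1 - η) * C * ∫ τ in (0:ℝ)..t, uOnOff Δ η τ := by
    simp only [hS, mul_assoc, uOnOff_mul_self, intervalIntegral.integral_const_mul]
    ring
  have hpos : 0 < 1 - η := sub_pos.2 hη.2
  refine ⟨fun t _ => ⟨key t, ?_⟩, fun t ht => mul_pos (mul_pos (mul_pos hC hη.1) hpos) ht⟩
  calc C * η * (1 - η) * t = (1 - η) * C * (η * t) := by ring
    _ ≤ (1 - η) * C * ∫ τ in (0:ℝ)..t, uOnOff Δ η τ :=
      mul_le_mul_of_nonneg_left (mul_le_integral_uOnOff hΔ ⟨hη.1.le, hη.2.le⟩)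
        (mul_pos hpos hC).le
    _ = _ := (key t).symm
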